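/- (Corollary, no-feedback Dueck capacity) Consider the generalized Dueck DMBC without feedback, and assume H(Z₀,Z₁) ≤ 1 and H(Z₀,Z₂) ≤ 1. Then the zero-common-rate slice of the no-feedback capacity region, {(R₁,R₂) : (0,R₁,R₂) ∈ C_NoFB}, equals the set of all nonnegative pairs (R₁,R₂) satisfying R₁ ≤ 2 − H(Z₀,Z₁), R₂ ≤ 2 − H(Z₀,Z₂), and R₁+R₂ ≤ 3 − H(Z₀,Z₁,Z₂) − I(Z₁;Z₂|Z₀). -/

import Mathlib

open scoped BigOperators Classical

noncomputable section

namespace BCFB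

variable {Ω A B C : Type*}

/-- Probability of an event under a weight function on a finite sample space. -/
def prOf [Fintype Ω] (w : Ω → ℝ) (E : Ω → Prop) : ℝ :=
  ∑ ω, if E ω then w ω else 0

/-- Distribution (pushforward) of a random variable. -/
def distOf [Fintype Ω] (w : Ω → ℝ) (X : Ω → A) : A → ℝ :=
  fun a => prOf w fun ω => X ω = a

/-- Shannon entropy (base 2) of a random variable. -/
def entOf [Fintype Ω] [Fintype A] (w : Ω → ℝ) (X : Ω → A) : ℝ :=
  -∑ a, distOf w X a * Real.logb 2 (distOf w X a)

/-- Mutual information (base 2). -/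
def miOf [Fintype Ω] [Fintype A] [Fintype B] (w : Ω → ℝ) (X : Ω → A) (Y : Ω → B) : ℝ :=
  entOf w X + entOf w Y - entOf w fun ω => (X ω, Y ω)

/-- Conditional mutual information I(X;Y|Z) (base 2). -/
def cmiOf [Fintype Ω] [Fintype A] [Fintype B] [Fintype C]
    (w : Ω → ℝ) (X : Ω → A) (Y : Ω → B) (Z : Ω → C) : ℝ :=
  entOf w (fun ω => (X ω, Z ω)) + entOf w (fun ω => (Y ω, Z ω))
    - entOf w (fun ω => (X ω, Y ω, Z ω)) - entOf w Z

/-- `w` is a probability mass function. -/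
def IsPMF [Fintype Ω] (w : Ω → ℝ) : Prop := (∀ ω, 0 ≤ w ω) ∧ ∑ ω, w ω = 1

/-- `k` is a transition kernel (each row a pmf). -/
def IsKernel {A B : Type*} [Fintype A] [Fintype B] (k : A → B → ℝ) : Prop :=
  ∀ a, IsPMF (k a)

/-- `X — Y — Z` forms a Markov chain (i.e. `X` and `Z` are conditionally
independent given `Y`). -/
def MarkovChain [Fintype Ω] (w : Ω → ℝ) (X : Ω → A) (Y : Ω → B) (Z : Ω → C) : Prop :=
  ∀ a b c,
    distOf w (fun ω => (X ω, Y ω, Z ω)) (a, b, c) * distOf w Y b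
      = distOf w (fun ω => (X ω, Y ω)) (a, b) * distOf w (fun ω => (Z ω, Y ω)) (c, b)

/-- `X` and `Y` are independent. -/
def IndepRV [Fintype Ω] (w : Ω → ℝ) (X : Ω → A) (Y : Ω → B) : Prop :=
  ∀ a b, distOf w (fun ω => (X ω, Y ω)) (a, b) = distOf w X a * distOf w Y b

/-- Number of messages of rate `R` and blocklength `n`: `⌊2^{nR}⌋`. -/
def msgCard (n : ℕ) (R : ℝ) : ℕ := ⌊(2 : ℝ) ^ ((n : ℝ) * R)⌋₊

/-- Binary entropy function. -/
def hb (u : ℝ) : ℝ := -(u * Real.logb 2 u) - (1 - u) * Real.logb 2 (1 - u)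

/-- Empirical frequency of the letter `a` in the sequence `x`. -/
def freqOf {A : Type*} {n : ℕ} (x : Fin n → A) (a : A) : ℝ :=
  ((Finset.univ.filter fun t => x t = a).card : ℝ) / n

/-- `ε`-typicality of a sequence w.r.t. a pmf `P`. -/
def Typical {A : Type*} (ε : ℝ) {n : ℕ} (P : A → ℝ) (x : Fin n → A) : Prop :=
  ∀ a, |freqOf x a - P a| ≤ ε * P a

section NoFB

variable {X Y1 Y2 : Type*} [Fintype X] [Fintype Y1] [Fintype Y2]

/-- Error probability of a blocklength-`n` no-feedback code over the DMBC `W`. -/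
def errProbNoFB (W : X → Y1 × Y2 → ℝ) (n : ℕ) (R0 R1 R2 : ℝ)
    (enc : Fin (msgCard n R0) × Fin (msgCard n R1) × Fin (msgCard n R2) → Fin n → X)
    (dec1 : (Fin n → Y1) → Fin (msgCard n R0) × Fin (msgCard n R1))
    (dec2 : (Fin n → Y2) → Fin (msgCard n R0) × Fin (msgCard n R2)) : ℝ :=
  (1 / ((msgCard n R0 : ℝ) * (msgCard n R1 : ℝ) * (msgCard n R2 : ℝ))) *
    ∑ m : Fin (msgCard n R0) × Fin (msgCard n R1) × Fin (msgCard n R2),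
      ∑ y : Fin n → Y1 × Y2,
        (∏ t, W (enc m t) (y t)) *
          (if dec1 (fun t => (y t).1) ≠ (m.1, m.2.1) ∨ dec2 (fun t => (y t).2) ≠ (m.1, m.2.2)
            then 1 else 0)

/-- Achievability of a rate triple over the DMBC `W` without feedback. -/
def AchievableNoFB (W : X → Y1 × Y2 → ℝ) (R0 R1 R2 : ℝ) : Prop :=
  0 ≤ R0 ∧ 0 ≤ R1 ∧ 0 ≤ R2 ∧
    ∃ enc : (n : ℕ) →
        Fin (msgCard n R0) × Fin (msgCard n R1) × Fin (msgCard n R2) → Fin n → X,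
    ∃ dec1 : (n : ℕ) → (Fin n → Y1) → Fin (msgCard n R0) × Fin (msgCard n R1),
    ∃ dec2 : (n : ℕ) → (Fin n → Y2) → Fin (msgCard n R0) × Fin (msgCard n R2),
      Filter.Tendsto (fun n => errProbNoFB W n R0 R1 R2 (enc n) (dec1 n) (dec2 n))
        Filter.atTop (nhds 0)

/-- The no-feedback capacity region. -/
def CNoFB (W : X → Y1 × Y2 → ℝ) : Set (ℝ × ℝ × ℝ) :=
  closure {r | AchievableNoFB W r.1 r.2.1 r.2.2}

end NoFB

section FB

variable {X Y1 Y2 Yt : Type*} [Fintype X] [Fintype Y1] [Fintype Y2] [Fintype Yt]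

/-- Causality: the time-`t` channel input depends only on feedback symbols before time `t`. -/
def Causal {X Yt : Type*} (n : ℕ) {M : Type*} (enc : Fin n → M → (Fin n → Yt) → X) : Prop :=
  ∀ (t : Fin n) (m : M) (fb fb' : Fin n → Yt),
    (∀ s : Fin n, (s : ℕ) < (t : ℕ) → fb s = fb' s) → enc t m fb = enc t m fb'

/-- Error probability of a blocklength-`n` feedback code over the DMBC with
generalized feedback `W`. -/
def errProbFB (W : X → Y1 × Y2 × Yt → ℝ) (n : ℕ) (R0 R1 R2 : ℝ)
    (enc : Fin n → Fin (msgCard n R0) × Fin (msgCard n R1) × Fin (msgCard n R2) →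
      (Fin n → Yt) → X)
    (dec1 : (Fin n → Y1) → Fin (msgCard n R0) × Fin (msgCard n R1))
    (dec2 : (Fin n → Y2) → Fin (msgCard n R0) × Fin (msgCard n R2)) : ℝ :=
  (1 / ((msgCard n R0 : ℝ) * (msgCard n R1 : ℝ) * (msgCard n R2 : ℝ))) *
    ∑ m : Fin (msgCard n R0) × Fin (msgCard n R1) × Fin (msgCard n R2),
      ∑ y : Fin n → Y1 × Y2 × Yt,
        (∏ t, W (enc t m fun s => (y s).2.2) (y t)) *
          (if dec1 (fun t => (y t).1) ≠ (m.1, m.2.1) ∨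
              dec2 (fun t => (y t).2.1) ≠ (m.1, m.2.2)
            then 1 else 0)

/-- Achievability of a rate triple over the DMBC with generalized feedback `W`. -/
def AchievableFB (W : X → Y1 × Y2 × Yt → ℝ) (R0 R1 R2 : ℝ) : Prop :=
  0 ≤ R0 ∧ 0 ≤ R1 ∧ 0 ≤ R2 ∧
    ∃ enc : (n : ℕ) → Fin n →
        Fin (msgCard n R0) × Fin (msgCard n R1) × Fin (msgCard n R2) → (Fin n → Yt) → X,
    ∃ dec1 : (n : ℕ) → (Fin n → Y1) → Fin (msgCard n R0) × Fin (msgCard n R1),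
    ∃ dec2 : (n : ℕ) → (Fin n → Y2) → Fin (msgCard n R0) × Fin (msgCard n R2),
      (∀ n, Causal n (enc n)) ∧
      Filter.Tendsto (fun n => errProbFB W n R0 R1 R2 (enc n) (dec1 n) (dec2 n))
        Filter.atTop (nhds 0)

/-- Capacity region of the DMBC with generalized feedback `W`. -/
def CGenFB (W : X → Y1 × Y2 × Yt → ℝ) : Set (ℝ × ℝ × ℝ) :=
  closure {r | AchievableFB W r.1 r.2.1 r.2.2}

end FB

/-- Extension of a DMBC to a generalized-feedback channel with noiseless feedback
`Ỹ = (Y₁, Y₂)`. -/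
def noiselessExt {X Y1 Y2 : Type*} (W : X → Y1 × Y2 → ℝ) :
    X → Y1 × Y2 × (Y1 × Y2) → ℝ :=
  fun x y => if y.2.2 = (y.1, y.2.1) then W x (y.1, y.2.1) else 0

/-- Capacity region of a DMBC with noiseless feedback. -/
def CNoiselessFB {X Y1 Y2 : Type*} [Fintype X] [Fintype Y1] [Fintype Y2]
    (W : X → Y1 × Y2 → ℝ) : Set (ℝ × ℝ × ℝ) :=
  CGenFB (noiselessExt W)

section Marton

variable {X Y1 Y2 : Type*} [Fintype X] [Fintype Y1] [Fintype Y2]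

/-- The single-letter Marton constraints for the rate triple `(R0,R1,R2)`. -/
def MartonCond (W : X → Y1 × Y2 → ℝ) (R0 R1 R2 : ℝ) : Prop :=
  ∃ (k0 k1 k2 : ℕ) (p : Fin k0 × Fin k1 × Fin k2 → ℝ)
    (f : Fin k0 × Fin k1 × Fin k2 → X), IsPMF p ∧
    (let w : (Fin k0 × Fin k1 × Fin k2) × Y1 × Y2 → ℝ := fun z => p z.1 * W (f z.1) z.2
     let U0 := fun z : (Fin k0 × Fin k1 × Fin k2) × Y1 × Y2 => z.1.1
     let U1 := fun z : (Fin k0 × Fin k1 × Fin k2) × Y1 × Y2 => z.1.2.1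
     let U2 := fun z : (Fin k0 × Fin k1 × Fin k2) × Y1 × Y2 => z.1.2.2
     let Yr1 := fun z : (Fin k0 × Fin k1 × Fin k2) × Y1 × Y2 => z.2.1
     let Yr2 := fun z : (Fin k0 × Fin k1 × Fin k2) × Y1 × Y2 => z.2.2
     R0 < min (miOf w U0 Yr1) (miOf w U0 Yr2) ∧
     R0 + R1 < miOf w (fun z => (U0 z, U1 z)) Yr1 ∧
     R0 + R2 < miOf w (fun z => (U0 z, U2 z)) Yr2 ∧
     R0 + R1 + R2 < cmiOf w U1 Yr1 U0 + cmiOf w U2 Yr2 U0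
       + min (miOf w U0 Yr1) (miOf w U0 Yr2) - cmiOf w U1 U2 U0)

/-- Marton's achievable region for the DMBC `W` without feedback. -/
def MartonRegion (W : X → Y1 × Y2 → ℝ) : Set (ℝ × ℝ × ℝ) :=
  closure {r | 0 ≤ r.1 ∧ 0 ≤ r.2.1 ∧ 0 ≤ r.2.2 ∧ MartonCond W r.1 r.2.1 r.2.2}

end Marton

end BCFB
namespace BCFB

/-- The generalized Dueck DMBC: input `x = (x₁, x₀, x₂)`, outputs
`y₁ = (x₁⊕z₁, x₀⊕z₀)` and `y₂ = (x₀⊕z₀, x₂⊕z₂)` where `(z₀,z₁,z₂) ~ PZ`. -/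
def dueckW (PZ : Bool × Bool × Bool → ℝ) :
    Bool × Bool × Bool → (Bool × Bool) × Bool × Bool → ℝ :=
  fun x y =>
    if y.2.1 = y.1.2 then
      PZ (Bool.xor x.2.1 y.1.2, Bool.xor x.1 y.1.1, Bool.xor x.2.2 y.2.2)
    else 0

/-- The generalized Dueck DMBC with the noisy feedback
`Ỹ = (Y₁₁⊕W₁, Y₁₀⊕W₀, Y₂₂⊕W₂)`, with feedback-noise law `Q` on `(W₀,W₁,W₂)`. -/
def dueckNoisyW (PZ : Bool × Bool × Bool → ℝ) (Q : Bool × Bool × Bool → ℝ) :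
    Bool × Bool × Bool →
      (Bool × Bool) × (Bool × Bool) × (Bool × Bool × Bool) → ℝ :=
  fun x y =>
    dueckW PZ x (y.1, y.2.1) *
      Q (Bool.xor y.2.2.2.1 y.1.2, Bool.xor y.2.2.1 y.1.1, Bool.xor y.2.2.2.2 y.2.1.2)

end BCFB
namespace BCFB

/-- Real-valued indicator of a proposition. -/
def ind (p : Prop) : ℝ := if p then 1 else 0

theorem ite_eq_ind (p : Prop) [Decidable p] : (if p then (1 : ℝ) else 0) = ind p := by
  unfold ind; congr

theorem ind_of_true {p : Prop} (h : p) : ind p = 1 := if_pos h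

theorem ind_of_false {p : Prop} (h : ¬p) : ind p = 0 := if_neg h

theorem ind_nonneg (p : Prop) : 0 ≤ ind p := by
  unfold ind; split_ifs <;> norm_num

theorem ind_le_one (p : Prop) : ind p ≤ 1 := by
  unfold ind; split_ifs <;> norm_num

theorem ind_mono {p q : Prop} (h : p → q) : ind p ≤ ind q := by
  by_cases hp : p
  · rw [ind_of_true hp, ind_of_true (h hp)]
  · rw [ind_of_false hp]; exact ind_nonneg q

theorem ind_or_le (p q : Prop) : ind (p ∨ q) ≤ ind p + ind q := by
  by_cases hp : p <;> by_cases hq : q <;> simp [ind, hp, hq]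

theorem ind_not (p : Prop) : ind (¬p) = 1 - ind p := by
  by_cases hp : p <;> simp [ind, hp]

/-- Expectation of `F` over `n` i.i.d. draws from `w`. -/
def iidE {Ω : Type*} [Fintype Ω] (n : ℕ) (w : Ω → ℝ) (F : (Fin n → Ω) → ℝ) : ℝ :=
  ∑ x, (∏ t, w (x t)) * F x

section iid

variable {Ω A : Type*} [Fintype Ω] [Fintype A]

theorem sum_prod_distOf {n : ℕ} (w : Ω → ℝ) (X : Fin n → Ω → A) (F : (Fin n → A) → ℝ) :
    ∑ a : Fin n → A, (∏ t, distOf w (X t) (a t)) * F a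
      = iidE n w fun ω => F fun t => X t (ω t) := by
  have h : ∀ a : Fin n → A, (∏ t, distOf w (X t) (a t))
      = ∑ ω : Fin n → Ω, if (fun t => X t (ω t)) = a then ∏ t, w (ω t) else 0 := by
    intro a
    unfold distOf prOf
    rw [Finset.prod_univ_sum, Fintype.piFinset_univ]
    refine Finset.sum_congr rfl fun ω _ => ?_
    rw [Finset.prod_ite_zero]
    simp [funext_iff]
  simp_rw [h, Finset.sum_mul]
  rw [Finset.sum_comm]
  unfold iidE
  refine Finset.sum_congr rfl fun ω _ => ?_
  simp [ite_mul]

theorem iidE_distOf {n : ℕ} (w : Ω → ℝ) (X : Ω → A) (F : (Fin n → A) → ℝ) :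
    iidE n (distOf w X) F = iidE n w fun ω => F fun t => X (ω t) :=
  sum_prod_distOf w (fun _ => X) F

theorem iidE_mono {n : ℕ} {w : Ω → ℝ} (hw : IsPMF w) {F G : (Fin n → Ω) → ℝ}
    (h : ∀ x, F x ≤ G x) : iidE n w F ≤ iidE n w G :=
  Finset.sum_le_sum fun x _ =>
    mul_le_mul_of_nonneg_left (h x) (Finset.prod_nonneg fun t _ => hw.1 (x t))

theorem iidE_add {n : ℕ} (w : Ω → ℝ) (F G : (Fin n → Ω) → ℝ) :
    iidE n w (fun x => F x + G x) = iidE n w F + iidE n w G := by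
  simp [iidE, mul_add, Finset.sum_add_distrib]

theorem iidE_sum {n : ℕ} {ι : Type*} (s : Finset ι) (w : Ω → ℝ) (F : ι → (Fin n → Ω) → ℝ) :
    iidE n w (fun x => ∑ i ∈ s, F i x) = ∑ i ∈ s, iidE n w (F i) := by
  simp only [iidE, Finset.mul_sum]
  exact Finset.sum_comm

theorem iidE_const {n : ℕ} {w : Ω → ℝ} (hw : IsPMF w) (c : ℝ) :
    iidE n w (fun _ => c) = c := by
  have h := Finset.prod_univ_sum (fun _ : Fin n => (Finset.univ : Finset Ω)) (fun _ => w)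
  rw [Fintype.piFinset_univ] at h
  unfold iidE
  rw [← Finset.sum_mul, ← h, hw.2]
  simp

theorem iidE_const_mul {n : ℕ} (w : Ω → ℝ) (c : ℝ) (F : (Fin n → Ω) → ℝ) :
    iidE n w (fun x => c * F x) = c * iidE n w F := by
  simp only [iidE, Finset.mul_sum]
  exact Finset.sum_congr rfl fun x _ => by ring

theorem iidE_succ {n : ℕ} (w : Ω → ℝ) (F : (Fin (n + 1) → Ω) → ℝ) :
    iidE (n + 1) w F = ∑ a, w a * iidE n w fun x => F (Fin.cons a x) := by
  unfold iidE
  rw [← (Fin.consEquiv fun _ => Ω).sum_comp, Fintype.sum_prod_type]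
  refine Finset.sum_congr rfl fun a _ => ?_
  rw [Finset.mul_sum]
  refine Finset.sum_congr rfl fun x _ => ?_
  simp [Fin.consEquiv, Fin.prod_univ_succ, mul_assoc]

theorem iidE_sum_apply {n : ℕ} {w : Ω → ℝ} (hw : IsPMF w) {h : Ω → ℝ}
    (h0 : ∑ ω, w ω * h ω = 0) : iidE n w (fun x => ∑ t, h (x t)) = 0 := by
  induction n with
  | zero => simp [iidE]
  | succ n ih =>
    simp [iidE_succ, Fin.sum_univ_succ, iidE_add, iidE_const hw, ih, h0]

theorem iidE_sq_sum_apply {n : ℕ} {w : Ω → ℝ} (hw : IsPMF w) {h : Ω → ℝ}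
    (h0 : ∑ ω, w ω * h ω = 0) :
    iidE n w (fun x => (∑ t, h (x t)) ^ 2) = n * ∑ ω, w ω * h ω ^ 2 := by
  induction n with
  | zero => simp [iidE]
  | succ n ih =>
    simp only [iidE_succ, Fin.sum_univ_succ, add_sq, iidE_add, iidE_const hw, iidE_const_mul, ih,
      iidE_sum_apply hw h0, Fin.cons_zero, Fin.cons_succ, mul_zero, add_zero, mul_add,
      Finset.sum_add_distrib]
    rw [← Finset.sum_mul, hw.2]
    push_cast
    ring

/-- Weak law of large numbers for products of likelihoods. -/
theorem iidE_atypical_le {w : Ω → ℝ} (hw : IsPMF w) {f : Ω → ℝ}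
    (hf : ∀ ω, 0 < w ω → 0 < f ω) {μ : ℝ} (hμ : -∑ ω, w ω * Real.logb 2 (f ω) = μ) :
    ∃ V : ℝ, ∀ n : ℕ, 0 < n → ∀ δ : ℝ, 0 < δ →
      iidE n w (fun x => ind ¬((2 : ℝ) ^ (-(n * (μ + δ))) ≤ ∏ t, f (x t) ∧
        ∏ t, f (x t) ≤ (2 : ℝ) ^ (-(n * (μ - δ))))) ≤ V / (n * δ ^ 2) := by
  set h : Ω → ℝ := fun ω => Real.logb 2 (f ω) + μ with hh
  have h0 : ∑ ω, w ω * h ω = 0 := by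
    simp only [hh, mul_add, Finset.sum_add_distrib]
    rw [← Finset.sum_mul, hw.2, ← hμ]; ring
  refine ⟨∑ ω, w ω * h ω ^ 2, fun n hn δ hδ => ?_⟩
  have hn' : (0 : ℝ) < n := by exact_mod_cast hn
  have key : iidE n w (fun x => ind ¬((2 : ℝ) ^ (-(n * (μ + δ))) ≤ ∏ t, f (x t) ∧
        ∏ t, f (x t) ≤ (2 : ℝ) ^ (-(n * (μ - δ)))))
      ≤ iidE n w (fun x => (1 / (n * δ) ^ 2) * (∑ t, h (x t)) ^ 2) := by
    refine Finset.sum_le_sum fun x _ => ?_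
    rcases (Finset.prod_nonneg fun t _ => hw.1 (x t) : 0 ≤ ∏ t, w (x t)).eq_or_lt with hz | hz
    · simp [← hz]
    refine mul_le_mul_of_nonneg_left ?_ hz.le
    have hpos : ∀ t, 0 < f (x t) := fun t => hf _ <| (hw.1 _).lt_of_ne' fun h => by
      rw [Finset.prod_eq_zero (Finset.mem_univ t) h] at hz
      exact lt_irrefl _ hz
    have hprod : ∏ t, f (x t) = (2 : ℝ) ^ (∑ t, h (x t) - n * μ) := by
      have : ∑ t, h (x t) - n * μ = ∑ t, Real.logb 2 (f (x t)) := by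
        simp [hh, Finset.sum_add_distrib]
      rw [this, Real.rpow_sum_of_pos (by norm_num)]
      exact Finset.prod_congr rfl fun t _ =>
        (Real.rpow_logb (by norm_num) (by norm_num) (hpos t)).symm
    by_cases hs : |∑ t, h (x t)| ≤ n * δ
    · beta_reduce
      rw [ind_of_false]
      · positivity
      · rw [not_not, hprod]
        obtain ⟨h1, h2⟩ := abs_le.1 hs
        constructor <;> refine Real.rpow_le_rpow_of_exponent_le (by norm_num) ?_ <;> linarith
    · refine (ind_le_one _).trans ?_
      beta_reduce
      rw [one_div, inv_mul_eq_div, one_le_div (by positivity), ← sq_abs (∑ t, h (x t))]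
      exact pow_le_pow_left₀ (by positivity) (not_le.1 hs).le 2
  refine key.trans (le_of_eq ?_)
  rw [iidE_const_mul, iidE_sq_sum_apply hw h0]
  field_simp

end iid

section coding

variable {Ω S : Type*} [Fintype Ω]

theorem sum_ind_le_of_likelihood {W : S → Bool → ℝ} (hW0 : ∀ s b, 0 ≤ W s b)
    (hW1 : ∀ s, ∑ b, W s b ≤ 1) {n : ℕ} (L : ℝ) (s : Fin n → S) :
    ∑ v : Fin n → Bool, ind ((2 : ℝ) ^ (-L) ≤ ∏ t, W (s t) (v t)) ≤ (2 : ℝ) ^ L := by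
  have h1 : ∑ v : Fin n → Bool, ∏ t, W (s t) (v t) ≤ 1 := by
    have h := Finset.prod_univ_sum (fun _ : Fin n => (Finset.univ : Finset Bool))
      (fun t => W (s t))
    rw [Fintype.piFinset_univ] at h
    rw [← h]
    exact Finset.prod_le_one (fun t _ => Finset.sum_nonneg fun b _ => hW0 _ b) fun t _ => hW1 _
  have hL : (0 : ℝ) < 2 ^ L := by positivity
  calc _ ≤ ∑ v : Fin n → Bool, (2 : ℝ) ^ L * ∏ t, W (s t) (v t) := by
        refine Finset.sum_le_sum fun v _ => ?_
        by_cases hv : (2 : ℝ) ^ (-L) ≤ ∏ t, W (s t) (v t)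
        · rw [ind_of_true hv]
          rw [Real.rpow_neg (by norm_num)] at hv
          calc (1 : ℝ) = 2 ^ L * (2 ^ L)⁻¹ := (mul_inv_cancel₀ hL.ne').symm
            _ ≤ _ := mul_le_mul_of_nonneg_left hv hL.le
        · rw [ind_of_false hv]
          exact mul_nonneg hL.le (Finset.prod_nonneg fun t _ => hW0 _ _)
    _ ≤ _ := by rw [← Finset.mul_sum]; exact mul_le_of_le_one_right hL.le h1

/-- Two codewords of a uniformly random codebook differ by a uniform vector. -/
theorem sum_codebook_xor {K : Type*} [Fintype K] {n : ℕ} (g : (Fin n → Bool) → ℝ)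
    {k k' : K} (hk : k' ≠ k) (z : Fin n → Bool) :
    (2 : ℝ) ^ n * ∑ c : K → Fin n → Bool, g (fun t => ((c k t).xor (z t)).xor (c k' t))
      = Fintype.card (K → Fin n → Bool) * ∑ v, g v := by
  have hshift : ∀ v : Fin n → Bool,
      ∑ c : K → Fin n → Bool, g (fun t => ((c k t).xor (z t)).xor (c k' t))
        = ∑ c : K → Fin n → Bool, g (fun t => (v t).xor (((c k t).xor (z t)).xor (c k' t))) := by
    intro v
    have hi : Function.Involutive fun (c : K → Fin n → Bool) (j : K) (t : Fin n) =>
        (c j t).xor (if j = k then v t else false) := by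
      intro c; funext j t; simp
    rw [← Equiv.sum_comp (hi.toPerm _)]
    refine Finset.sum_congr rfl fun c _ => ?_
    congr 1; funext t
    simp only [Function.Involutive.coe_toPerm, if_true, if_neg hk]
    cases c k t <;> cases c k' t <;> cases v t <;> cases z t <;> rfl
  have hunif : ∀ u : Fin n → Bool, ∑ v : Fin n → Bool, g (fun t => (v t).xor (u t))
      = ∑ v, g v := by
    intro u
    have hi : Function.Involutive fun (v : Fin n → Bool) (t : Fin n) => (v t).xor (u t) := by
      intro v; funext t; simp
    exact Equiv.sum_comp (hi.toPerm _) g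
  have hcard : (2 : ℝ) ^ n = ∑ _v : Fin n → Bool, (1 : ℝ) := by simp
  rw [hcard, Finset.sum_mul]
  simp_rw [one_mul]
  rw [Finset.sum_congr rfl fun v _ => hshift v, Finset.sum_comm]
  simp_rw [hunif]
  simp

/-- Random coding over a binary additive-noise channel with the state `s` at the decoder. -/
theorem exists_code {w : Ω → ℝ} (hw : IsPMF w) (s : Ω → S) (x : Ω → Bool) {W : S → Bool → ℝ}
    (hW0 : ∀ s b, 0 ≤ W s b) (hW1 : ∀ s, ∑ b, W s b ≤ 1) {n : ℕ} (L : ℝ)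
    {K M : Type*} [Fintype K] [Nonempty K] [Fintype M] (ι : M → K) :
    ∃ (c : K → Fin n → Bool) (d : (Fin n → S) → (Fin n → Bool) → K),
      ∑ m, iidE n w (fun z => ind (d (fun t => s (z t))
          (fun t => (c (ι m) t).xor (x (z t))) ≠ ι m))
        ≤ Fintype.card M *
          (iidE n w (fun z => ind ¬((2 : ℝ) ^ (-L) ≤ ∏ t, W (s (z t)) (x (z t))))
            + (Fintype.card K - 1) * ((2 : ℝ) ^ L / 2 ^ n)) := by
  set T : (Fin n → S) → (Fin n → Bool) → Prop :=
    fun s v => (2 : ℝ) ^ (-L) ≤ ∏ t, W (s t) (v t) with hT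
  let d : (K → Fin n → Bool) → (Fin n → S) → (Fin n → Bool) → K := fun c σ y =>
    if h : ∃ k, T σ (fun t => (y t).xor (c k t)) then h.choose else Classical.arbitrary K
  have herr : ∀ c σ v k, ind (d c σ (fun t => (c k t).xor (v t)) ≠ k) ≤ ind (¬T σ v)
      + ∑ k' ∈ Finset.univ.erase k, ind (T σ fun t => ((c k t).xor (v t)).xor (c k' t)) := by
    intro c σ v k
    have hnn : ∀ k' ∈ Finset.univ.erase k,
        0 ≤ ind (T σ fun t => ((c k t).xor (v t)).xor (c k' t)) := fun _ _ => ind_nonneg _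
    by_cases hv : T σ v
    · by_cases hd : d c σ (fun t => (c k t).xor (v t)) = k
      · rw [ind_of_false (not_not.2 hd)]
        exact add_nonneg (ind_nonneg _) (Finset.sum_nonneg hnn)
      · have hex : ∃ k', T σ (fun t => ((c k t).xor (v t)).xor (c k' t)) := by
          refine ⟨k, ?_⟩
          convert hv using 2
          rename_i t
          cases c k t <;> cases v t <;> rfl
        have hdc : d c σ (fun t => (c k t).xor (v t)) = hex.choose := dif_pos hex
        have hmem : hex.choose ∈ Finset.univ.erase k := by
          rw [← hdc]; simpa using hd
        have := Finset.single_le_sum hnn hmem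
        rw [ind_of_true hex.choose_spec] at this
        have h1 := ind_le_one (d c σ (fun t => (c k t).xor (v t)) ≠ k)
        have h2 := ind_nonneg (¬T σ v)
        linarith
    · rw [ind_of_true hv]
      have h1 := ind_le_one (d c σ (fun t => (c k t).xor (v t)) ≠ k)
      have h2 := Finset.sum_nonneg hnn
      linarith
  have havg : ∀ σ v k, ∑ c : K → Fin n → Bool, ind (d c σ (fun t => (c k t).xor (v t)) ≠ k)
      ≤ Fintype.card (K → Fin n → Bool) * (ind (¬T σ v)
        + (Fintype.card K - 1) * ((2 : ℝ) ^ L / 2 ^ n)) := by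
    intro σ v k
    refine (Finset.sum_le_sum fun c _ => herr c σ v k).trans ?_
    rw [Finset.sum_add_distrib, Finset.sum_comm]
    have hpair : ∀ k' ∈ Finset.univ.erase k,
        ∑ c : K → Fin n → Bool, ind (T σ fun t => ((c k t).xor (v t)).xor (c k' t))
          ≤ Fintype.card (K → Fin n → Bool) * ((2 : ℝ) ^ L / 2 ^ n) := by
      intro k' hk'
      have h := sum_codebook_xor (fun u => ind (T σ u)) (Finset.ne_of_mem_erase hk') v
      have h2 := sum_ind_le_of_likelihood hW0 hW1 L σ
      rw [mul_div_assoc', le_div_iff₀ (by positivity), mul_comm, h]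
      exact mul_le_mul_of_nonneg_left h2 (by positivity)
    have hsum := Finset.sum_le_sum hpair
    have hK : ((Finset.univ.erase k).card : ℝ) = Fintype.card K - 1 := by
      rw [Finset.card_erase_of_mem (Finset.mem_univ k), Finset.card_univ,
        Nat.cast_pred Fintype.card_pos]
    rw [Finset.sum_const, nsmul_eq_mul, hK] at hsum
    rw [Finset.sum_const, nsmul_eq_mul, Finset.card_univ]
    linarith
  obtain ⟨c, -, hc⟩ := Finset.exists_le_of_sum_le
    (s := (Finset.univ : Finset (K → Fin n → Bool))) Finset.univ_nonempty
    (f := fun c => ∑ m, iidE n w (fun z => ind (d c (fun t => s (z t))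
          (fun t => (c (ι m) t).xor (x (z t))) ≠ ι m)))
    (g := fun _ => Fintype.card M *
          (iidE n w (fun z => ind ¬(T (fun t => s (z t)) (fun t => x (z t))))
            + (Fintype.card K - 1) * ((2 : ℝ) ^ L / 2 ^ n))) (by
      rw [Finset.sum_comm]
      rw [Finset.sum_congr rfl fun m _ => (iidE_sum _ _ _).symm]
      refine (Finset.sum_le_sum fun m _ => iidE_mono hw fun z => havg (fun t => s (z t)) (fun t => x (z t)) (ι m)).trans ?_
      simp_rw [iidE_const_mul, iidE_add, iidE_const hw]
      simp only [Finset.sum_const, nsmul_eq_mul, Finset.card_univ]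
      exact le_of_eq (by ring))
  exact ⟨c, d c, hc⟩

end coding

section entropy

variable {Ω A B : Type*} [Fintype Ω]

theorem sum_distOf_mul [Fintype A] (w : Ω → ℝ) (X : Ω → A) (f : A → ℝ) :
    ∑ a, distOf w X a * f a = ∑ ω, w ω * f (X ω) := by
  simp only [distOf, prOf, Finset.sum_mul]
  rw [Finset.sum_comm]
  exact Finset.sum_congr rfl fun ω _ => by simp [ite_mul]

theorem isPMF_distOf [Fintype A] {w : Ω → ℝ} (hw : IsPMF w) (X : Ω → A) :
    IsPMF (distOf w X) := by
  refine ⟨fun a => Finset.sum_nonneg fun ω _ => ?_, ?_⟩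
  · split_ifs
    exacts [hw.1 ω, le_rfl]
  · simpa [hw.2] using sum_distOf_mul w X fun _ => 1

theorem distOf_nonneg {w : Ω → ℝ} (hw : IsPMF w) (X : Ω → A) (a : A) : 0 ≤ distOf w X a := by
  refine Finset.sum_nonneg fun ω _ => ?_
  split_ifs
  exacts [hw.1 ω, le_rfl]

theorem le_distOf_apply {w : Ω → ℝ} (hw : IsPMF w) (X : Ω → A) (ω : Ω) :
    w ω ≤ distOf w X (X ω) := by
  unfold distOf prOf
  have h := Finset.single_le_sum (f := fun ω' => if X ω' = X ω then w ω' else 0)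
    (fun ω' _ => by
      split_ifs
      exacts [hw.1 ω', le_rfl]) (Finset.mem_univ ω)
  simpa using h

theorem sum_distOf_prodMk [Fintype B] (w : Ω → ℝ) (X : Ω → A) (Y : Ω → B) (a : A) :
    ∑ b, distOf w (fun ω => (X ω, Y ω)) (a, b) = distOf w X a := by
  simp only [distOf, prOf, Prod.mk.injEq, ite_and]
  rw [Finset.sum_comm]
  refine Finset.sum_congr rfl fun ω _ => ?_
  split_ifs <;> simp

theorem entOf_eq_sum [Fintype A] (w : Ω → ℝ) (X : Ω → A) :
    entOf w X = -∑ ω, w ω * Real.logb 2 (distOf w X (X ω)) := by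
  rw [entOf, sum_distOf_mul w X fun a => Real.logb 2 (distOf w X a)]

theorem entOf_nonneg [Fintype A] {w : Ω → ℝ} (hw : IsPMF w) (X : Ω → A) : 0 ≤ entOf w X := by
  have h := isPMF_distOf hw X
  refine neg_nonneg.2 (Finset.sum_nonpos fun a _ => ?_)
  refine mul_nonpos_of_nonneg_of_nonpos (h.1 a) (Real.logb_nonpos (by norm_num) (h.1 a) ?_)
  rw [← h.2]
  exact Finset.single_le_sum (fun a _ => h.1 a) (Finset.mem_univ a)

theorem entOf_prodMk_sub [Fintype A] [Fintype B] {w : Ω → ℝ} (hw : IsPMF w) (X : Ω → A)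
    (Y : Ω → B) :
    -∑ ω, w ω * Real.logb 2 (distOf w (fun ω => (X ω, Y ω)) (X ω, Y ω) / distOf w X (X ω))
      = entOf w (fun ω => (X ω, Y ω)) - entOf w X := by
  rw [entOf_eq_sum, entOf_eq_sum, neg_sub_neg, ← Finset.sum_sub_distrib, ← Finset.sum_neg_distrib]
  refine Finset.sum_congr rfl fun ω _ => ?_
  rcases (hw.1 ω).eq_or_lt with h | h
  · simp [← h]
  · rw [Real.logb_div]
    · ring
    · exact (h.trans_le (le_distOf_apply hw (fun ω => (X ω, Y ω)) ω)).ne'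
    · exact (h.trans_le (le_distOf_apply hw X ω)).ne'

theorem entOf_le_entOf_prodMk [Fintype A] [Fintype B] {w : Ω → ℝ} (hw : IsPMF w) (X : Ω → A)
    (Y : Ω → B) : entOf w X ≤ entOf w (fun ω => (X ω, Y ω)) := by
  rw [← sub_nonneg, ← entOf_prodMk_sub hw]
  refine neg_nonneg.2 (Finset.sum_nonpos fun ω _ => ?_)
  refine mul_nonpos_of_nonneg_of_nonpos (hw.1 ω) (Real.logb_nonpos (by norm_num) ?_ ?_)
  · exact div_nonneg (distOf_nonneg hw _ _) (distOf_nonneg hw _ _)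
  · refine div_le_one_of_le₀ ?_ (distOf_nonneg hw _ _)
    rw [← sum_distOf_prodMk w X Y]
    exact Finset.single_le_sum (f := fun b => distOf w (fun ω => (X ω, Y ω)) (X ω, b))
      (fun b _ => distOf_nonneg hw _ _) (Finset.mem_univ _)

end entropy

theorem tendsto_rpow_mul_nat {r : ℝ} (hr : r < 0) :
    Filter.Tendsto (fun n : ℕ => (2 : ℝ) ^ ((n : ℝ) * r)) Filter.atTop (nhds 0) := by
  have h : ∀ n : ℕ, (2 : ℝ) ^ ((n : ℝ) * r) = ((2 : ℝ) ^ r) ^ n := fun n => by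
    rw [mul_comm, Real.rpow_mul (by norm_num), Real.rpow_natCast]
  simp_rw [h]
  exact tendsto_pow_atTop_nhds_zero_of_lt_one (by positivity)
    (Real.rpow_lt_one_of_one_lt_of_neg (by norm_num) hr)

theorem tendsto_const_div_nat_mul (V c : ℝ) :
    Filter.Tendsto (fun n : ℕ => V / ((n : ℝ) * c)) Filter.atTop (nhds 0) := by
  have h : ∀ n : ℕ, V / ((n : ℝ) * c) = V / c / n := fun n => by rw [div_div, mul_comm]
  simp_rw [h]
  exact tendsto_const_div_atTop_nhds_zero_nat _

/-- Asymptotic form of random coding: rates below `1 - H(X|S)` are reliable. -/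
theorem exists_code_of_rate_lt {Ω S : Type*} [Fintype Ω] [Fintype S] {w : Ω → ℝ} (hw : IsPMF w)
    (s : Ω → S) (x : Ω → Bool) {a : ℝ}
    (ha : a = 0 ∨ a < 1 - (entOf w (fun ω => (s ω, x ω)) - entOf w s)) :
    ∃ ε : ℕ → ℝ, Filter.Tendsto ε Filter.atTop (nhds 0) ∧ ∀ n : ℕ, 0 < n →
      ∀ (K M : Type) [Fintype K] [Nonempty K] [Fintype M] (ι : M → K),
      (Fintype.card K : ℝ) - 1 ≤ (if a = 0 then 0 else 4 * (2 : ℝ) ^ (n * a)) →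
      ∃ (c : K → Fin n → Bool) (d : (Fin n → S) → (Fin n → Bool) → K),
        ∑ m, iidE n w (fun z => ind (d (fun t => s (z t))
          (fun t => (c (ι m) t).xor (x (z t))) ≠ ι m)) ≤ Fintype.card M * ε n := by
  set μ := entOf w (fun ω => (s ω, x ω)) - entOf w s with hμ
  set W : S → Bool → ℝ := fun σ b => distOf w (fun ω => (s ω, x ω)) (σ, b) / distOf w s σ with hW
  have hW0 : ∀ σ b, 0 ≤ W σ b := fun σ b =>
    div_nonneg (distOf_nonneg hw _ _) (distOf_nonneg hw _ _)
  have hW1 : ∀ σ, ∑ b, W σ b ≤ 1 := fun σ => by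
    simp only [hW]
    rw [← Finset.sum_div, sum_distOf_prodMk]
    exact div_self_le_one _
  obtain ⟨V, hV⟩ := iidE_atypical_le hw (f := fun ω => W (s ω) (x ω))
    (fun ω h => div_pos (h.trans_le (le_distOf_apply hw (fun ω => (s ω, x ω)) ω))
      (h.trans_le (le_distOf_apply hw s ω))) (entOf_prodMk_sub hw s x)
  obtain ⟨δ, hδ, hδa⟩ : ∃ δ : ℝ, 0 < δ ∧ (a ≠ 0 → a + (μ + δ) - 1 < 0) := by
    by_cases h : a = 0
    · exact ⟨1, one_pos, fun h' => absurd h h'⟩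
    · have h' := ha.resolve_left h
      exact ⟨(1 - μ - a) / 2, by linarith, fun _ => by linarith⟩
  refine ⟨fun n => V / (n * δ ^ 2) + (if a = 0 then 0 else 4 * (2 : ℝ) ^ (n * a)) *
    ((2 : ℝ) ^ (n * (μ + δ)) / 2 ^ n), ?_, ?_⟩
  · suffices h : Filter.Tendsto (fun n : ℕ => (if a = 0 then 0 else 4 * (2 : ℝ) ^ (n * a)) *
        ((2 : ℝ) ^ (n * (μ + δ)) / 2 ^ n)) Filter.atTop (nhds 0) by
      have h' := (tendsto_const_div_nat_mul V (δ ^ 2)).add h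
      rwa [zero_add (0 : ℝ)] at h'
    by_cases h : a = 0
    · simp [h]
    · have h4 := (tendsto_rpow_mul_nat (hδa h)).const_mul 4
      rw [mul_zero] at h4
      refine h4.congr fun n => ?_
      rw [if_neg h, mul_sub, mul_add, Real.rpow_sub (by norm_num), Real.rpow_add (by norm_num),
        mul_one, Real.rpow_natCast]
      ring
  · intro n hn K M _ _ _ ι hK
    obtain ⟨c, d, hcd⟩ := exists_code hw s x hW0 hW1 (n * (μ + δ)) ι
    refine ⟨c, d, hcd.trans ?_⟩
    refine mul_le_mul_of_nonneg_left (add_le_add ?_ ?_) (by positivity)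
    · exact (iidE_mono hw fun z => ind_mono fun h h' => h h'.1).trans (hV n hn δ hδ)
    · exact mul_le_mul_of_nonneg_right hK (by positivity)

/-- Output pair of the Dueck channel as a function of the input and the noise. -/
def dueckOut (x z : Bool × Bool × Bool) : (Bool × Bool) × Bool × Bool :=
  ((x.1.xor z.2.1, x.2.1.xor z.1), (x.2.1.xor z.1, x.2.2.xor z.2.2))

theorem dueckW_eq_distOf (PZ : Bool × Bool × Bool → ℝ) (x : Bool × Bool × Bool) :
    dueckW PZ x = distOf PZ (dueckOut x) := by
  funext y
  obtain ⟨x1, x0, x2⟩ := x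
  obtain ⟨⟨a, b⟩, c, d⟩ := y
  cases x1 <;> cases x0 <;> cases x2 <;> cases a <;> cases b <;> cases c <;> cases d <;>
    simp [dueckW, dueckOut, distOf, prOf, Fintype.sum_prod_type]

theorem errProbNoFB_dueckW (PZ : Bool × Bool × Bool → ℝ) (n : ℕ) (R0 R1 R2 : ℝ)
    (enc : Fin (msgCard n R0) × Fin (msgCard n R1) × Fin (msgCard n R2) →
      Fin n → Bool × Bool × Bool)
    (dec1 : (Fin n → Bool × Bool) → Fin (msgCard n R0) × Fin (msgCard n R1))
    (dec2 : (Fin n → Bool × Bool) → Fin (msgCard n R0) × Fin (msgCard n R2)) :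
    errProbNoFB (dueckW PZ) n R0 R1 R2 enc dec1 dec2
      = (1 / ((msgCard n R0 : ℝ) * (msgCard n R1 : ℝ) * (msgCard n R2 : ℝ))) *
        ∑ m, iidE n PZ fun z =>
          ind (dec1 (fun t => (dueckOut (enc m t) (z t)).1) ≠ (m.1, m.2.1) ∨
            dec2 (fun t => (dueckOut (enc m t) (z t)).2) ≠ (m.1, m.2.2)) := by
  unfold errProbNoFB
  congr 1
  refine Finset.sum_congr rfl fun m _ => ?_
  simp_rw [ite_eq_ind, dueckW_eq_distOf]
  exact sum_prod_distOf PZ (fun t => dueckOut (enc m t)) fun y =>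
    ind (dec1 (fun t => (y t).1) ≠ (m.1, m.2.1) ∨ dec2 (fun t => (y t).2) ≠ (m.1, m.2.2))

theorem one_le_two_rpow {n : ℕ} {R : ℝ} (hR : 0 ≤ R) : (1 : ℝ) ≤ 2 ^ ((n : ℝ) * R) :=
  Real.one_le_rpow (by norm_num) (by positivity)

theorem msgCard_pos (n : ℕ) {R : ℝ} (hR : 0 ≤ R) : 0 < msgCard n R :=
  Nat.floor_pos.2 (one_le_two_rpow hR)

theorem two_rpow_le_two_mul_msgCard (n : ℕ) {R : ℝ} (hR : 0 ≤ R) :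
    (2 : ℝ) ^ ((n : ℝ) * R) ≤ 2 * msgCard n R := by
  have h1 : (1 : ℝ) ≤ msgCard n R := by exact_mod_cast msgCard_pos n hR
  have h2 := Nat.lt_floor_add_one ((2 : ℝ) ^ ((n : ℝ) * R))
  change _ < (msgCard n R : ℝ) + 1 at h2
  linarith

/-- Messages of rate `c + b` embed into pairs of messages of rates `c` and `b`. -/
theorem exists_injective_split (n : ℕ) {c b : ℝ} :
    ∃ e : Fin (msgCard n (c + b)) →
      Fin ⌈(2 : ℝ) ^ ((n : ℝ) * c)⌉₊ × Fin ⌈(2 : ℝ) ^ ((n : ℝ) * b)⌉₊, Function.Injective e := by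
  have h : msgCard n (c + b) ≤ ⌈(2 : ℝ) ^ ((n : ℝ) * c)⌉₊ * ⌈(2 : ℝ) ^ ((n : ℝ) * b)⌉₊ := by
    refine Nat.floor_le_of_le ?_
    rw [mul_add, Real.rpow_add (by norm_num)]
    push_cast
    exact mul_le_mul (Nat.le_ceil _) (Nat.le_ceil _) (by positivity) (by positivity)
  exact ⟨fun i => finProdFinEquiv.symm (Fin.castLE h i),
    finProdFinEquiv.symm.injective.comp (Fin.castLE_injective h)⟩

theorem ceil_two_rpow_sub_one_le (n : ℕ) {a : ℝ} :
    (⌈(2 : ℝ) ^ ((n : ℝ) * a)⌉₊ : ℝ) - 1 ≤ if a = 0 then 0 else 4 * (2 : ℝ) ^ ((n : ℝ) * a) := by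
  split_ifs with h
  · simp [h]
  · have h0 : (0 : ℝ) < 2 ^ ((n : ℝ) * a) := by positivity
    have h1 := Nat.ceil_lt_add_one h0.le
    linarith

theorem ceil_mul_ceil_sub_one_le (n : ℕ) {a b : ℝ} (ha : 0 ≤ a) (hb : 0 ≤ b) :
    (⌈(2 : ℝ) ^ ((n : ℝ) * a)⌉₊ : ℝ) * ⌈(2 : ℝ) ^ ((n : ℝ) * b)⌉₊ - 1
      ≤ if a + b = 0 then 0 else 4 * (2 : ℝ) ^ ((n : ℝ) * (a + b)) := by
  split_ifs with h
  · obtain ⟨rfl, rfl⟩ : a = 0 ∧ b = 0 := ⟨by linarith, by linarith⟩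
    simp
  · have h1 := one_le_two_rpow (n := n) ha
    have h2 := one_le_two_rpow (n := n) hb
    have h3 := (Nat.ceil_lt_add_one (zero_le_one.trans h1)).le
    have h4 := (Nat.ceil_lt_add_one (zero_le_one.trans h2)).le
    rw [mul_add, Real.rpow_add (by norm_num)]
    have h5 := mul_le_mul h3 h4 (by positivity) (by positivity)
    nlinarith

theorem achievableNoFB_dueckW_of_split {PZ : Bool × Bool × Bool → ℝ} (hPZ : IsPMF PZ)
    {b1 b2 c1 c2 : ℝ} (hb1 : 0 ≤ b1) (hb2 : 0 ≤ b2) (hc1 : 0 ≤ c1) (hc2 : 0 ≤ c2)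
    (h0 : b1 + b2 = 0 ∨ b1 + b2 < 1 - entOf PZ (fun z => z.1))
    (h1 : c1 = 0 ∨ c1 < 1 - (entOf PZ (fun z => (z.1, z.2.1)) - entOf PZ (fun z => z.1)))
    (h2 : c2 = 0 ∨ c2 < 1 - (entOf PZ (fun z => (z.1, z.2.2)) - entOf PZ (fun z => z.1))) :
    AchievableNoFB (dueckW PZ) 0 (c1 + b1) (c2 + b2) := by
  refine ⟨le_rfl, add_nonneg hc1 hb1, add_nonneg hc2 hb2, ?_⟩
  have hunit : entOf PZ (fun z => ((), z.1)) - entOf PZ (fun _ => ())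
      = entOf PZ (fun z => z.1) := by
    have e1 : entOf PZ (fun _ => ()) = 0 := by
      simp [entOf_eq_sum, distOf, prOf, hPZ.2]
    have e2 : entOf PZ (fun z => ((), z.1)) = entOf PZ (fun z => z.1) := by
      simp [entOf_eq_sum, distOf]
    rw [e1, e2, sub_zero]
  obtain ⟨ε0, hε0, H0⟩ := exists_code_of_rate_lt hPZ (fun _ => ()) (fun z => z.1)
    (a := b1 + b2) (by rwa [hunit])
  obtain ⟨ε1, hε1, H1⟩ := exists_code_of_rate_lt hPZ (fun z => z.1) (fun z => z.2.1) h1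
  obtain ⟨ε2, hε2, H2⟩ := exists_code_of_rate_lt hPZ (fun z => z.1) (fun z => z.2.2) h2
  have hM0 : ∀ n, Nonempty (Fin (msgCard n 0)) := fun n => ⟨⟨0, msgCard_pos n le_rfl⟩⟩
  have hM1 : ∀ n, Nonempty (Fin (msgCard n (c1 + b1))) := fun n =>
    ⟨⟨0, msgCard_pos n (add_nonneg hc1 hb1)⟩⟩
  have hM2 : ∀ n, Nonempty (Fin (msgCard n (c2 + b2))) := fun n =>
    ⟨⟨0, msgCard_pos n (add_nonneg hc2 hb2)⟩⟩
  have hsub : ∀ n, Subsingleton (Fin (msgCard n 0)) := fun n => by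
    have : msgCard n 0 = 1 := by simp [msgCard]
    rw [this]; infer_instance
  have hne : ∀ (n : ℕ) (a : ℝ), Nonempty (Fin ⌈(2 : ℝ) ^ ((n : ℝ) * a)⌉₊) := fun n a =>
    ⟨⟨0, Nat.ceil_pos.2 (by positivity)⟩⟩
  have main : ∀ n : ℕ, ∃ (enc : Fin (msgCard n 0) × Fin (msgCard n (c1 + b1)) ×
      Fin (msgCard n (c2 + b2)) → Fin n → Bool × Bool × Bool)
      (dec1 : (Fin n → Bool × Bool) → Fin (msgCard n 0) × Fin (msgCard n (c1 + b1)))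
      (dec2 : (Fin n → Bool × Bool) → Fin (msgCard n 0) × Fin (msgCard n (c2 + b2))),
      0 < n → errProbNoFB (dueckW PZ) n 0 (c1 + b1) (c2 + b2) enc dec1 dec2
        ≤ ε0 n + ε1 n + ε2 n := by
    intro n
    rcases Nat.eq_zero_or_pos n with rfl | hn
    · exact ⟨Classical.arbitrary _, Classical.arbitrary _, Classical.arbitrary _,
        fun h => absurd h (lt_irrefl 0)⟩
    obtain ⟨e1, he1⟩ := exists_injective_split n (c := c1) (b := b1)
    obtain ⟨e2, he2⟩ := exists_injective_split n (c := c2) (b := b2)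
    let M := Fin (msgCard n 0) × Fin (msgCard n (c1 + b1)) × Fin (msgCard n (c2 + b2))
    let k0 : M → _ := fun m => ((e1 m.2.1).2, (e2 m.2.2).2)
    let k1 : M → _ := fun m => (e1 m.2.1).1
    let k2 : M → _ := fun m => (e2 m.2.2).1
    obtain ⟨f0, d0, hd0⟩ := H0 n hn _ M k0 (by
      simpa using ceil_mul_ceil_sub_one_le n hb1 hb2)
    obtain ⟨f1, d1, hd1⟩ := H1 n hn _ M k1 (by
      simpa using ceil_two_rpow_sub_one_le n (a := c1))
    obtain ⟨f2, d2, hd2⟩ := H2 n hn _ M k2 (by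
      simpa using ceil_two_rpow_sub_one_le n (a := c2))
    let j0 : (Fin n → Bool) → _ := d0 fun _ => ()
    let ns : (Fin n → Bool) → Fin n → Bool := fun y t => (y t).xor (f0 (j0 y) t)
    refine ⟨fun m t => (f1 (k1 m) t, f0 (k0 m) t, f2 (k2 m) t),
      fun y => (Classical.arbitrary _, Function.invFun e1
        (d1 (ns fun t => (y t).2) (fun t => (y t).1), (j0 fun t => (y t).2).1)),
      fun y => (Classical.arbitrary _, Function.invFun e2
        (d2 (ns fun t => (y t).1) (fun t => (y t).2), (j0 fun t => (y t).1).2)), fun _ => ?_⟩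
    rw [errProbNoFB_dueckW]
    have hbound := Finset.sum_le_sum fun (m : M) (_ : m ∈ Finset.univ) => iidE_mono (n := n) hPZ
      (F := fun z => ind ((Classical.arbitrary (Fin (msgCard n 0)), Function.invFun e1
          (d1 (ns fun t => (f0 (k0 m) t).xor (z t).1) (fun t => (f1 (k1 m) t).xor (z t).2.1),
            (j0 fun t => (f0 (k0 m) t).xor (z t).1).1)) ≠ (m.1, m.2.1) ∨
        (Classical.arbitrary (Fin (msgCard n 0)), Function.invFun e2
          (d2 (ns fun t => (f0 (k0 m) t).xor (z t).1) (fun t => (f2 (k2 m) t).xor (z t).2.2),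
            (j0 fun t => (f0 (k0 m) t).xor (z t).1).2)) ≠ (m.1, m.2.2)))
      (G := fun z => ind (j0 (fun t => (f0 (k0 m) t).xor (z t).1) ≠ k0 m)
        + ind (d1 (fun t => (z t).1) (fun t => (f1 (k1 m) t).xor (z t).2.1) ≠ k1 m)
        + ind (d2 (fun t => (z t).1) (fun t => (f2 (k2 m) t).xor (z t).2.2) ≠ k2 m)) (by
        intro z
        refine le_trans ?_ (add_le_add_left (ind_or_le _ _) _)
        refine le_trans (ind_mono fun h => ?_) (ind_or_le _ _)
        by_contra hcon
        push Not at hcon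
        obtain ⟨⟨hj, hk1⟩, hk2⟩ := hcon
        have hns : (ns fun t => (f0 (k0 m) t).xor (z t).1) = fun t => (z t).1 := by
          funext t
          simp only [ns, hj]
          cases f0 (k0 m) t <;> simp
        rw [hns, hj, hk1, hk2] at h
        have hi1 : Function.invFun e1 (k1 m, (k0 m).1) = m.2.1 :=
          Function.leftInverse_invFun he1 m.2.1
        have hi2 : Function.invFun e2 (k2 m, (k0 m).2) = m.2.2 :=
          Function.leftInverse_invFun he2 m.2.2
        rw [hi1, hi2, Subsingleton.elim (Classical.arbitrary (Fin (msgCard n 0))) m.1] at h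
        simp at h)
    simp_rw [iidE_add, Finset.sum_add_distrib] at hbound
    have hcard : (0 : ℝ) < Fintype.card M := by
      exact_mod_cast Fintype.card_pos
    have hcard' : (msgCard n 0 : ℝ) * (msgCard n (c1 + b1) : ℝ) * (msgCard n (c2 + b2) : ℝ)
        = Fintype.card M := by
      simp [M, mul_assoc]
    rw [hcard', one_div, inv_mul_le_iff₀ hcard]
    refine hbound.trans ?_
    rw [mul_add, mul_add]
    exact add_le_add (add_le_add hd0 hd1) hd2
  choose enc dec1 dec2 hmain using main
  refine ⟨enc, dec1, dec2, ?_⟩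
  have hlim := (hε0.add hε1).add hε2
  rw [add_zero (0 : ℝ), add_zero (0 : ℝ)] at hlim
  refine tendsto_of_tendsto_of_tendsto_of_le_of_le' tendsto_const_nhds hlim
    (Filter.Eventually.of_forall fun n => ?_) ?_
  · rw [errProbNoFB_dueckW]
    refine mul_nonneg (by positivity) (Finset.sum_nonneg fun m _ => ?_)
    exact (iidE_const hPZ 0).symm.le.trans (iidE_mono hPZ fun z => ind_nonneg _)
  · filter_upwards [Filter.eventually_gt_atTop 0] with n hn using hmain n hn

theorem sum_success_le {Ω M K Y : Type*} [Fintype Ω] [Fintype M] [Fintype Y] {w : Ω → ℝ}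
    (hw : IsPMF w) {n : ℕ} (κ : M → K) {out : M → (Fin n → Ω) → Y}
    (hout : ∀ m, Function.Injective (out m)) (dec : Y → K) {F : ℝ}
    (hF : ∀ k, ∑ m, ind (κ m = k) ≤ F) {B : ℝ} (hB : 0 ≤ B) :
    ∑ m, iidE n w (fun z => ind (dec (out m z) = κ m))
      ≤ Fintype.card M * iidE n w (fun z => ind ¬(∏ t, w (z t) ≤ B))
        + Fintype.card Y * F * B := by
  have h1 : ∀ m, iidE n w (fun z => ind (dec (out m z) = κ m))
      ≤ iidE n w (fun z => ind ¬(∏ t, w (z t) ≤ B)) + (∑ y, ind (κ m = dec y)) * B := by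
    intro m
    have hsum : ∑ z, ind (κ m = dec (out m z)) ≤ ∑ y, ind (κ m = dec y) := by
      rw [← Finset.sum_image (f := fun y => ind (κ m = dec y)) (hout m).injOn]
      exact Finset.sum_le_sum_of_subset_of_nonneg (Finset.subset_univ _)
        fun _ _ _ => ind_nonneg _
    refine le_trans ?_ (add_le_add_right (mul_le_mul_of_nonneg_right hsum hB) _)
    unfold iidE
    rw [Finset.sum_mul, ← Finset.sum_add_distrib]
    refine Finset.sum_le_sum fun z _ => ?_
    have hz : 0 ≤ ∏ t, w (z t) := Finset.prod_nonneg fun t _ => hw.1 _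
    simp_rw [eq_comm (a := κ m)]
    by_cases hzB : ∏ t, w (z t) ≤ B
    · rw [ind_of_false (not_not.2 hzB), mul_zero, zero_add, mul_comm]
      exact mul_le_mul_of_nonneg_left hzB (ind_nonneg _)
    · rw [ind_of_true hzB]
      have h2 := mul_le_mul_of_nonneg_left (ind_le_one (dec (out m z) = κ m)) hz
      have h3 := mul_nonneg (ind_nonneg (dec (out m z) = κ m)) hB
      linarith
  refine (Finset.sum_le_sum fun m _ => h1 m).trans ?_
  rw [Finset.sum_add_distrib, ← Finset.sum_mul, Finset.sum_comm, Finset.sum_const, nsmul_eq_mul,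
    Finset.card_univ]
  refine add_le_add_right (mul_le_mul_of_nonneg_right ?_ hB) _
  refine (Finset.sum_le_sum fun y _ => hF (dec y)).trans (le_of_eq ?_)
  rw [Finset.sum_const, nsmul_eq_mul, Finset.card_univ]

/-- Converse for additive-noise-like channels: noise of entropy `H` acting injectively on an
output space of exponent `D` leaves at most rate `D - H` decodable. -/
theorem rate_le_of_tendsto_error {Ω : Type*} [Fintype Ω] {w : Ω → ℝ} (hw : IsPMF w)
    {M K Y : ℕ → Type} [∀ n, Fintype (M n)] [∀ n, Nonempty (M n)] [∀ n, Fintype (Y n)]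
    (κ : ∀ n, M n → K n) {out : ∀ n, M n → (Fin n → Ω) → Y n}
    (hout : ∀ n m, Function.Injective (out n m)) (dec : ∀ n, Y n → K n) {F : ℕ → ℝ}
    (hF : ∀ n k, ∑ m, ind (κ n m = k) ≤ F n) {R D C : ℝ}
    (hR : ∀ n, F n / Fintype.card (M n) ≤ C * (2 : ℝ) ^ (-(n * R)))
    (hD : ∀ n, (Fintype.card (Y n) : ℝ) = (2 : ℝ) ^ (n * D))
    (herr : Filter.Tendsto (fun n => (1 / (Fintype.card (M n) : ℝ)) *
      ∑ m, iidE n w fun z => ind (dec n (out n m z) ≠ κ n m)) Filter.atTop (nhds 0)) :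
    R ≤ D - -∑ ω, w ω * Real.logb 2 (w ω) := by
  by_contra hcon
  set μ := -∑ ω, w ω * Real.logb 2 (w ω) with hμ
  obtain ⟨V, hV⟩ := iidE_atypical_le hw (f := w) (fun _ h => h) hμ.symm
  obtain ⟨δ, hδ, hδR⟩ : ∃ δ : ℝ, 0 < δ ∧ D - R - (μ - δ) < 0 :=
    ⟨(R - (D - μ)) / 2, by linarith, by linarith⟩
  have hlim : Filter.Tendsto (fun n : ℕ => V / (n * δ ^ 2)
      + C * (2 : ℝ) ^ (n * (D - R - (μ - δ)))) Filter.atTop (nhds 0) := by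
    have h := (tendsto_const_div_nat_mul V (δ ^ 2)).add
      ((tendsto_rpow_mul_nat hδR).const_mul C)
    rwa [mul_zero, zero_add (0 : ℝ)] at h
  have hone : Filter.Tendsto (fun _ : ℕ => (1 : ℝ)) Filter.atTop (nhds 0) := by
    have hadd := herr.add hlim
    rw [zero_add (0 : ℝ)] at hadd
    refine tendsto_of_tendsto_of_tendsto_of_le_of_le' tendsto_const_nhds hadd
      (Filter.Eventually.of_forall fun _ => zero_le_one) ?_
    filter_upwards [Filter.eventually_gt_atTop 0] with n hn
    have hM : (0 : ℝ) < Fintype.card (M n) := by exact_mod_cast Fintype.card_pos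
    have hB : (0 : ℝ) ≤ 2 ^ (-(n * (μ - δ))) := by positivity
    have h1 := sum_success_le hw (κ n) (hout n) (dec n) (hF n) hB
    have h2 : iidE n w (fun z => ind ¬(∏ t, w (z t) ≤ (2 : ℝ) ^ (-(n * (μ - δ)))))
        ≤ V / (n * δ ^ 2) :=
      (iidE_mono hw fun z => ind_mono fun h h' => h h'.2).trans (hV n hn δ hδ)
    have h3 : ∑ m, iidE n w (fun z => ind (dec n (out n m z) = κ n m))
        + ∑ m, iidE n w (fun z => ind (dec n (out n m z) ≠ κ n m)) = Fintype.card (M n) := by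
      rw [← Finset.sum_add_distrib]
      simp_rw [← iidE_add, Ne, ind_not, add_sub_cancel, iidE_const hw]
      simp
    have h4 : Fintype.card (Y n) * F n * (2 : ℝ) ^ (-(n * (μ - δ)))
        ≤ Fintype.card (M n) * (C * (2 : ℝ) ^ (n * (D - R - (μ - δ)))) := by
      have h5 := hR n
      rw [div_le_iff₀ hM] at h5
      have h6 : (2 : ℝ) ^ (n * (D - R - (μ - δ)))
          = 2 ^ (n * D) * 2 ^ (-(n * R)) * 2 ^ (-(n * (μ - δ))) := by
        rw [← Real.rpow_add (by norm_num), ← Real.rpow_add (by norm_num)]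
        congr 1; ring
      rw [hD, h6]
      calc _ = (2 : ℝ) ^ (n * D) * 2 ^ (-(n * (μ - δ))) * F n := by ring
        _ ≤ (2 : ℝ) ^ (n * D) * 2 ^ (-(n * (μ - δ))) * (C * 2 ^ (-(n * R)) * Fintype.card (M n)) :=
          mul_le_mul_of_nonneg_left h5 (by positivity)
        _ = _ := by ring
    have h7 := mul_le_mul_of_nonneg_left h2 hM.le
    rw [one_div, ← sub_le_iff_le_add, le_inv_mul_iff₀ hM]
    linarith
  exact one_ne_zero (tendsto_nhds_unique tendsto_const_nhds hone)

section noise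

variable {PZ : Bool × Bool × Bool → ℝ}

/-- The noise law with the same `(Z₀,Z₁)`- and `(Z₀,Z₂)`-marginals as `PZ` under which
`Z₁` and `Z₂` are conditionally independent given `Z₀`. -/
def condIndepNoise (PZ : Bool × Bool × Bool → ℝ) (z : Bool × Bool × Bool) : ℝ :=
  distOf PZ (fun z => (z.1, z.2.1)) (z.1, z.2.1) * distOf PZ (fun z => (z.1, z.2.2)) (z.1, z.2.2)
    / distOf PZ (fun z => z.1) z.1

theorem distOf_fst_eq_zero {Ω A B : Type*} [Fintype Ω] [Fintype B] {w : Ω → ℝ} (hw : IsPMF w)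
    (X : Ω → A) (Y : Ω → B) {a : A} (h : distOf w X a = 0) (b : B) :
    distOf w (fun ω => (X ω, Y ω)) (a, b) = 0 := by
  rw [← sum_distOf_prodMk w X Y, Finset.sum_eq_zero_iff_of_nonneg
    fun _ _ => distOf_nonneg hw _ _] at h
  exact h b (Finset.mem_univ b)

theorem distOf_condIndepNoise_left (hPZ : IsPMF PZ) :
    distOf (condIndepNoise PZ) (fun z => (z.1, z.2.1)) = distOf PZ (fun z => (z.1, z.2.1)) := by
  funext ⟨a, b⟩
  have h1 : distOf (condIndepNoise PZ) (fun z => (z.1, z.2.1)) (a, b)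
      = ∑ v, condIndepNoise PZ (a, b, v) := by
    cases a <;> cases b <;> simp [distOf, prOf, Fintype.sum_prod_type]
  rw [h1]
  simp only [condIndepNoise]
  rw [← Finset.sum_div, ← Finset.mul_sum, sum_distOf_prodMk PZ (fun z => z.1) fun z => z.2.2]
  by_cases h : distOf PZ (fun z => z.1) a = 0
  · rw [distOf_fst_eq_zero hPZ (fun z => z.1) (fun z => z.2.1) h, h]; simp
  · exact mul_div_cancel_right₀ _ h

theorem distOf_condIndepNoise_right (hPZ : IsPMF PZ) :
    distOf (condIndepNoise PZ) (fun z => (z.1, z.2.2)) = distOf PZ (fun z => (z.1, z.2.2)) := by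
  funext ⟨a, b⟩
  have h1 : distOf (condIndepNoise PZ) (fun z => (z.1, z.2.2)) (a, b)
      = ∑ v, condIndepNoise PZ (a, v, b) := by
    cases a <;> cases b <;> simp [distOf, prOf, Fintype.sum_prod_type]
  rw [h1]
  simp only [condIndepNoise]
  rw [← Finset.sum_div, ← Finset.sum_mul, sum_distOf_prodMk PZ (fun z => z.1) fun z => z.2.1]
  by_cases h : distOf PZ (fun z => z.1) a = 0
  · rw [distOf_fst_eq_zero hPZ (fun z => z.1) (fun z => z.2.2) h, h]; simp
  · exact mul_div_cancel_left₀ _ h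

theorem isPMF_condIndepNoise (hPZ : IsPMF PZ) : IsPMF (condIndepNoise PZ) := by
  refine ⟨fun z => div_nonneg (mul_nonneg ?_ ?_) ?_, ?_⟩
  · exact distOf_nonneg hPZ _ _
  · exact distOf_nonneg hPZ _ _
  · exact distOf_nonneg hPZ _ _
  · have h := sum_distOf_mul (condIndepNoise PZ) (fun z => (z.1, z.2.1)) fun _ => 1
    simp only [mul_one] at h
    rw [← h, distOf_condIndepNoise_left hPZ]
    exact (isPMF_distOf hPZ _).2

theorem entropy_condIndepNoise (hPZ : IsPMF PZ) :
    -∑ z, condIndepNoise PZ z * Real.logb 2 (condIndepNoise PZ z)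
      = entOf PZ (fun z => (z.1, z.2.1)) + entOf PZ (fun z => (z.1, z.2.2))
        - entOf PZ (fun z => z.1) := by
  have h0 : distOf (condIndepNoise PZ) (fun z => z.1) = distOf PZ (fun z => z.1) := by
    funext a
    rw [← sum_distOf_prodMk (condIndepNoise PZ) (fun z => z.1) fun z => z.2.1,
      distOf_condIndepNoise_left hPZ,
      sum_distOf_prodMk PZ (fun z => z.1) fun z => z.2.1]
  unfold entOf
  rw [← distOf_condIndepNoise_left hPZ, ← distOf_condIndepNoise_right hPZ, ← h0]
  rw [sum_distOf_mul _ _ fun a => Real.logb 2 (distOf _ _ a),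
    sum_distOf_mul _ _ fun a => Real.logb 2 (distOf _ _ a),
    sum_distOf_mul _ _ fun a => Real.logb 2 (distOf _ _ a),
    distOf_condIndepNoise_left hPZ, distOf_condIndepNoise_right hPZ, h0, ← neg_add,
    ← Finset.sum_add_distrib, neg_sub_neg, ← neg_sub, ← Finset.sum_sub_distrib]
  congr 1
  refine Finset.sum_congr rfl fun z _ => ?_
  by_cases h : condIndepNoise PZ z = 0
  · simp [h]
  · have h' := h
    unfold condIndepNoise at h'
    obtain ⟨h1, h2⟩ := div_ne_zero_iff.1 h'
    obtain ⟨h3, h4⟩ := mul_ne_zero_iff.1 h1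
    conv_lhs => rw [condIndepNoise.eq_def, Real.logb_div h1 h2, Real.logb_mul h3 h4]
    rw [condIndepNoise]
    ring

end noise

theorem inv_msgCard_le (n : ℕ) {R : ℝ} (hR : 0 ≤ R) :
    (msgCard n R : ℝ)⁻¹ ≤ 2 * (2 : ℝ) ^ (-(n * R)) := by
  have h := two_rpow_le_two_mul_msgCard n hR
  have hM : (0 : ℝ) < msgCard n R := by exact_mod_cast msgCard_pos n hR
  rw [Real.rpow_neg (by norm_num), ← div_eq_mul_inv, inv_le_comm₀ hM (by positivity), inv_div]
  linarith

theorem sum_ind_snd_fst {A B C : Type*} [Fintype A] [Fintype B] [Fintype C] (k : B) :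
    ∑ m : A × B × C, ind (m.2.1 = k) = Fintype.card A * Fintype.card C := by
  simp only [Fintype.sum_prod_type, ind]
  rw [Finset.sum_congr rfl fun _ _ => Finset.sum_comm]
  simp

theorem sum_ind_snd_snd {A B C : Type*} [Fintype A] [Fintype B] [Fintype C] (k : C) :
    ∑ m : A × B × C, ind (m.2.2 = k) = Fintype.card A * Fintype.card B := by
  simp only [Fintype.sum_prod_type, ind]
  simp

theorem rates_le_of_achievableNoFB_dueckW {PZ : Bool × Bool × Bool → ℝ} (hPZ : IsPMF PZ)
    {R0 R1 R2 : ℝ} (h : AchievableNoFB (dueckW PZ) R0 R1 R2) :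
    R1 ≤ 2 - entOf PZ (fun z => (z.1, z.2.1)) ∧ R2 ≤ 2 - entOf PZ (fun z => (z.1, z.2.2)) ∧
      R1 + R2 ≤ 3 - (entOf PZ (fun z => (z.1, z.2.1)) + entOf PZ (fun z => (z.1, z.2.2))
        - entOf PZ (fun z => z.1)) := by
  obtain ⟨hR0, hR1, hR2, enc, dec1, dec2, hlim⟩ := h
  let M : ℕ → Type := fun n => Fin (msgCard n R0) × Fin (msgCard n R1) × Fin (msgCard n R2)
  have p0 : ∀ n, (0 : ℝ) < msgCard n R0 := fun n => by exact_mod_cast msgCard_pos n hR0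
  have p1 : ∀ n, (0 : ℝ) < msgCard n R1 := fun n => by exact_mod_cast msgCard_pos n hR1
  have p2 : ∀ n, (0 : ℝ) < msgCard n R2 := fun n => by exact_mod_cast msgCard_pos n hR2
  have : ∀ n, Nonempty (M n) := fun n =>
    ⟨(⟨0, msgCard_pos n hR0⟩, ⟨0, msgCard_pos n hR1⟩, ⟨0, msgCard_pos n hR2⟩)⟩
  have hcard : ∀ n, (Fintype.card (M n) : ℝ)
      = (msgCard n R0 : ℝ) * (msgCard n R1 : ℝ) * (msgCard n R2 : ℝ) := fun n => by
    simp [M, mul_assoc]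
  have herr : ∀ n, errProbNoFB (dueckW PZ) n R0 R1 R2 (enc n) (dec1 n) (dec2 n)
      = (1 / (Fintype.card (M n) : ℝ)) * ∑ m : M n, iidE n PZ fun z =>
          ind (dec1 n (fun t => (dueckOut (enc n m t) (z t)).1) ≠ (m.1, m.2.1) ∨
            dec2 n (fun t => (dueckOut (enc n m t) (z t)).2) ≠ (m.1, m.2.2)) := fun n => by
    rw [errProbNoFB_dueckW, hcard]
  simp_rw [herr] at hlim
  have hnn : ∀ {Ω : Type} [Fintype Ω] {w : Ω → ℝ}, IsPMF w → ∀ n (p : M n → (Fin n → Ω) → Prop),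
      0 ≤ (1 / (Fintype.card (M n) : ℝ)) * ∑ m, iidE n w fun z => ind (p m z) :=
    fun hw n p => mul_nonneg (by positivity) <| Finset.sum_nonneg fun m _ =>
      (iidE_const hw 0).symm.le.trans (iidE_mono hw fun z => ind_nonneg _)
  have hlim1 : Filter.Tendsto (fun n => (1 / (Fintype.card (M n) : ℝ)) * ∑ m : M n,
      iidE n (distOf PZ fun z => (z.1, z.2.1)) fun u => ind ((dec1 n fun t =>
        ((enc n m t).1.xor (u t).2, (enc n m t).2.1.xor (u t).1)) ≠ (m.1, m.2.1)))
      Filter.atTop (nhds 0) := by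
    refine squeeze_zero (fun n => hnn (isPMF_distOf hPZ _) n _) (fun n => ?_) hlim
    refine mul_le_mul_of_nonneg_left (Finset.sum_le_sum fun m _ => ?_) (by positivity)
    rw [iidE_distOf]
    exact iidE_mono hPZ fun z => ind_mono Or.inl
  have hlim2 : Filter.Tendsto (fun n => (1 / (Fintype.card (M n) : ℝ)) * ∑ m : M n,
      iidE n (distOf PZ fun z => (z.1, z.2.2)) fun u => ind ((dec2 n fun t =>
        ((enc n m t).2.1.xor (u t).1, (enc n m t).2.2.xor (u t).2)) ≠ (m.1, m.2.2)))
      Filter.atTop (nhds 0) := by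
    refine squeeze_zero (fun n => hnn (isPMF_distOf hPZ _) n _) (fun n => ?_) hlim
    refine mul_le_mul_of_nonneg_left (Finset.sum_le_sum fun m _ => ?_) (by positivity)
    rw [iidE_distOf]
    exact iidE_mono hPZ fun z => ind_mono Or.inr
  refine ⟨?_, ?_, ?_⟩
  · refine rate_le_of_tendsto_error (isPMF_distOf hPZ fun z => (z.1, z.2.1)) (M := M)
      (Y := fun n => Fin n → Bool × Bool) (fun n m => m.2.1)
      (out := fun n m u t => ((enc n m t).1.xor (u t).2, (enc n m t).2.1.xor (u t).1))
      ?_ (fun n y => (dec1 n y).2) (F := fun n => msgCard n R0 * msgCard n R2) (C := 2)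
      ?_ ?_ ?_ ?_
    · intro n m u v huv
      funext t
      have := congrFun huv t
      simp only [Prod.mk.injEq, Bool.xor_right_inj] at this
      exact Prod.ext this.2 this.1
    · intro n k
      simpa using (sum_ind_snd_fst (A := Fin (msgCard n R0))
        (C := Fin (msgCard n R2)) k).le
    · intro n
      refine le_trans (le_of_eq ?_) (inv_msgCard_le n hR1)
      have := (p0 n).ne'
      have := (p1 n).ne'
      have := (p2 n).ne'
      rw [hcard]
      field_simp
    · intro n
      rw [mul_comm, Real.rpow_mul (by norm_num), Real.rpow_natCast]
      norm_num
    · refine squeeze_zero (fun n => hnn (isPMF_distOf hPZ _) n _) (fun n => ?_) hlim1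
      refine mul_le_mul_of_nonneg_left (Finset.sum_le_sum fun m _ => ?_) (by positivity)
      exact iidE_mono (isPMF_distOf hPZ _) fun z => ind_mono fun h h' => h (by rw [h'])
  · refine rate_le_of_tendsto_error (isPMF_distOf hPZ fun z => (z.1, z.2.2)) (M := M)
      (Y := fun n => Fin n → Bool × Bool) (fun n m => m.2.2)
      (out := fun n m u t => ((enc n m t).2.1.xor (u t).1, (enc n m t).2.2.xor (u t).2))
      ?_ (fun n y => (dec2 n y).2) (F := fun n => msgCard n R0 * msgCard n R1) (C := 2)
      ?_ ?_ ?_ ?_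
    · intro n m u v huv
      funext t
      have := congrFun huv t
      simp only [Prod.mk.injEq, Bool.xor_right_inj] at this
      exact Prod.ext this.1 this.2
    · intro n k
      simpa using (sum_ind_snd_snd (A := Fin (msgCard n R0))
        (B := Fin (msgCard n R1)) k).le
    · intro n
      refine le_trans (le_of_eq ?_) (inv_msgCard_le n hR2)
      have := (p0 n).ne'
      have := (p1 n).ne'
      have := (p2 n).ne'
      rw [hcard]
      field_simp
    · intro n
      rw [mul_comm, Real.rpow_mul (by norm_num), Real.rpow_natCast]
      norm_num
    · refine squeeze_zero (fun n => hnn (isPMF_distOf hPZ _) n _) (fun n => ?_) hlim2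
      refine mul_le_mul_of_nonneg_left (Finset.sum_le_sum fun m _ => ?_) (by positivity)
      exact iidE_mono (isPMF_distOf hPZ _) fun z => ind_mono fun h h' => h (by rw [h'])
  · rw [← entropy_condIndepNoise hPZ]
    refine rate_le_of_tendsto_error (isPMF_condIndepNoise hPZ) (M := M)
      (Y := fun n => Fin n → Bool × Bool × Bool) (fun n m => m.2)
      (out := fun n m z t => ((enc n m t).1.xor (z t).2.1, (enc n m t).2.1.xor (z t).1,
        (enc n m t).2.2.xor (z t).2.2))
      ?_ (fun n y => ((dec1 n fun t => ((y t).1, (y t).2.1)).2, (dec2 n fun t => (y t).2).2))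
      (F := fun n => msgCard n R0) (C := 4) ?_ ?_ ?_ ?_
    · intro n m u v huv
      funext t
      have := congrFun huv t
      simp only [Prod.mk.injEq, Bool.xor_right_inj] at this
      exact Prod.ext this.2.1 (Prod.ext this.1 this.2.2)
    · intro n k
      simp [M, Fintype.sum_prod_type, ind, Prod.ext_iff, ite_and]
    · intro n
      have h12 := mul_le_mul (inv_msgCard_le n hR1) (inv_msgCard_le n hR2)
        (inv_nonneg.2 (p2 n).le) (by positivity)
      have h3 : (msgCard n R0 : ℝ) / Fintype.card (M n)
          = (msgCard n R1 : ℝ)⁻¹ * (msgCard n R2 : ℝ)⁻¹ := by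
        have := (p0 n).ne'
        have := (p1 n).ne'
        have := (p2 n).ne'
        rw [hcard]
        field_simp
      rw [h3, mul_add, neg_add, Real.rpow_add (by norm_num)]
      linarith
    · intro n
      rw [mul_comm, Real.rpow_mul (by norm_num), Real.rpow_natCast]
      norm_num
    · have hadd := hlim1.add hlim2
      rw [zero_add (0 : ℝ)] at hadd
      refine squeeze_zero (fun n => hnn (isPMF_condIndepNoise hPZ) n _) (fun n => ?_) hadd
      rw [← mul_add, ← Finset.sum_add_distrib]
      refine mul_le_mul_of_nonneg_left (Finset.sum_le_sum fun m _ => ?_) (by positivity)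
      rw [← distOf_condIndepNoise_left hPZ, ← distOf_condIndepNoise_right hPZ, iidE_distOf,
        iidE_distOf, ← iidE_add]
      refine iidE_mono (isPMF_condIndepNoise hPZ) fun z => le_trans (ind_mono fun h => ?_)
        (ind_or_le _ _)
      by_contra hcon
      push Not at hcon
      exact h (by rw [hcon.1, hcon.2])

end BCFB
namespace BCFB

/-- **Corollary (no-feedback Dueck capacity).** No-feedback capacity of the generalized
Dueck DMBC (zero common rate slice), under `H(Z₀,Z₁) ≤ 1` and `H(Z₀,Z₂) ≤ 1`. -/
theorem dueck_noFB_capacity (PZ : Bool × Bool × Bool → ℝ) (hPZ : IsPMF PZ)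
    (h1 : entOf PZ (fun z => (z.1, z.2.1)) ≤ 1)
    (h2 : entOf PZ (fun z => (z.1, z.2.2)) ≤ 1) :
    {r : ℝ × ℝ | (0, r.1, r.2) ∈ CNoFB (dueckW PZ)} =
      {r : ℝ × ℝ | 0 ≤ r.1 ∧ 0 ≤ r.2 ∧
        r.1 ≤ 2 - entOf PZ (fun z => (z.1, z.2.1)) ∧
        r.2 ≤ 2 - entOf PZ (fun z => (z.1, z.2.2)) ∧
        r.1 + r.2 ≤ 3 - entOf PZ (fun z => z)
          - cmiOf PZ (fun z => z.2.1) (fun z => z.2.2) (fun z => z.1)} := by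
  have hsum : 3 - entOf PZ (fun z => z)
      - cmiOf PZ (fun z => z.2.1) (fun z => z.2.2) (fun z => z.1)
      = 3 - (entOf PZ (fun z => (z.1, z.2.1)) + entOf PZ (fun z => (z.1, z.2.2))
        - entOf PZ (fun z => z.1)) := by
    have e1 : entOf PZ (fun z => (z.2.1, z.1)) = entOf PZ (fun z => (z.1, z.2.1)) := by
      simp only [entOf_eq_sum, distOf, Prod.mk.injEq, and_comm]
    have e2 : entOf PZ (fun z => (z.2.2, z.1)) = entOf PZ (fun z => (z.1, z.2.2)) := by
      simp only [entOf_eq_sum, distOf, Prod.mk.injEq, and_comm]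
    have e3 : entOf PZ (fun z => (z.2.1, z.2.2, z.1)) = entOf PZ (fun z => z) := by
      simp only [entOf_eq_sum, distOf, Prod.ext_iff, and_comm, and_left_comm]
    rw [cmiOf, e1, e2, e3]
    ring
  rw [hsum]
  set H01 := entOf PZ (fun z => (z.1, z.2.1)) with hH01
  set H02 := entOf PZ (fun z => (z.1, z.2.2)) with hH02
  set H0 := entOf PZ (fun z => z.1) with hH0
  ext r
  constructor
  · intro hr
    have hclosed : IsClosed {r : ℝ × ℝ × ℝ | 0 ≤ r.2.1 ∧ 0 ≤ r.2.2 ∧ r.2.1 ≤ 2 - H01 ∧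
        r.2.2 ≤ 2 - H02 ∧ r.2.1 + r.2.2 ≤ 3 - (H01 + H02 - H0)} := by
      simp only [Set.ofPred_and]
      refine IsClosed.inter (isClosed_le ?_ ?_) <| IsClosed.inter (isClosed_le ?_ ?_) <|
        IsClosed.inter (isClosed_le ?_ ?_) <| IsClosed.inter (isClosed_le ?_ ?_)
          (isClosed_le ?_ ?_) <;> fun_prop
    refine closure_minimal ?_ hclosed hr
    intro q hq
    exact ⟨hq.2.1, hq.2.2.1, rates_le_of_achievableNoFB_dueckW hPZ hq⟩
  · rintro ⟨hr1, hr2, hb1, hb2, hb12⟩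
    have hp0 : 0 ≤ H0 := entOf_nonneg hPZ _
    have hp1 : H0 ≤ H01 := entOf_le_entOf_prodMk hPZ _ _
    have hp2 : H0 ≤ H02 := entOf_le_entOf_prodMk hPZ _ _
    obtain ⟨b1, b2, c1, c2, hb1', hb2', hc1', hc2', h0, hc1, hc2, e1, e2⟩ :
        ∃ b1 b2 c1 c2 : ℝ, 0 ≤ b1 ∧ 0 ≤ b2 ∧ 0 ≤ c1 ∧ 0 ≤ c2 ∧ b1 + b2 ≤ 1 - H0 ∧
          c1 ≤ 1 - (H01 - H0) ∧ c2 ≤ 1 - (H02 - H0) ∧ c1 + b1 = r.1 ∧ c2 + b2 = r.2 := by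
      refine ⟨r.1 - min r.1 (1 - (H01 - H0)), r.2 - min r.2 (1 - (H02 - H0)),
        min r.1 (1 - (H01 - H0)), min r.2 (1 - (H02 - H0)), ?_, ?_, ?_, ?_, ?_, min_le_right _ _,
        min_le_right _ _, by ring, by ring⟩
      · exact sub_nonneg.2 (min_le_left _ _)
      · exact sub_nonneg.2 (min_le_left _ _)
      · exact le_min hr1 (by linarith)
      · exact le_min hr2 (by linarith)
      · rcases min_cases r.1 (1 - (H01 - H0)) with ⟨h, -⟩ | ⟨h, -⟩ <;>
          rcases min_cases r.2 (1 - (H02 - H0)) with ⟨h', -⟩ | ⟨h', -⟩ <;>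
          rw [h, h'] <;> linarith
    have hstrict : ∀ {l x α : ℝ}, 0 < l → l < 1 → 0 ≤ x → x ≤ α → l * x = 0 ∨ l * x < α := by
      intro l x α hl hl1 hx hxα
      rcases hx.eq_or_lt with rfl | hx'
      · exact Or.inl (mul_zero l)
      · exact Or.inr ((mul_lt_of_lt_one_left hx' hl1).trans_le hxα)
    have hlim : Filter.Tendsto (fun l : ℝ => ((0 : ℝ), l * c1 + l * b1, l * c2 + l * b2))
        (nhdsWithin 1 (Set.Iio 1)) (nhds (0, r.1, r.2)) := by
      have hcont : Continuous fun l : ℝ => ((0 : ℝ), l * c1 + l * b1, l * c2 + l * b2) := by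
        fun_prop
      have h := hcont.tendsto 1
      simp only [one_mul, e1, e2] at h
      exact h.mono_left nhdsWithin_le_nhds
    refine mem_closure_of_tendsto hlim ?_
    filter_upwards [Ioo_mem_nhdsLT (zero_lt_one' ℝ)] with l hl
    refine achievableNoFB_dueckW_of_split hPZ (mul_nonneg hl.1.le hb1') (mul_nonneg hl.1.le hb2')
      (mul_nonneg hl.1.le hc1') (mul_nonneg hl.1.le hc2') ?_ (hstrict hl.1 hl.2 hc1' hc1)
      (hstrict hl.1 hl.2 hc2' hc2)
    rw [← mul_add]
    exact hstrict hl.1 hl.2 (add_nonneg hb1' hb2') h0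

end BCFB
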